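/- If q^8 ≠ 1, then the (−)-part U_q^-(A_N), presented by the quantum Serre relations, is a solvable polynomial algebra. Precisely: there exist a K-basis (b_α) of U_q^-(A_N) indexed by the finitely supported functions α : Λ_N → ℕ, with b_0 = 1 and b_{e_{(i,i+1)}} = F_i (where e_{(i,i+1)} is the indicator of (i,i+1)), and a monomial order ≺ on the finitely supported functions Λ_N → ℕ, such that for all α, β there are a nonzero scalar c_{α,β} ∈ K and an element f_{α,β} in the K-span of { b_γ : γ ≺ α + β } with b_α · b_β = c_{α,β} · b_{α+β} + f_{α,β}. -/

import Mathlib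

/-- The quantum Serre relations defining U_q^-(A_N): the generators F_0, …, F_{N-1}
(representing F_1, …, F_N) satisfy
F_i²F_j − (q² + q^{−2})F_iF_jF_i + F_jF_i² = 0 for |i − j| = 1, and
F_iF_j = F_jF_i for |i − j| ≥ 2. -/
inductive SerreRel (K : Type) [Field K] (q : K) (N : ℕ) :
    FreeAlgebra K (Fin N) → FreeAlgebra K (Fin N) → Prop
  | serre : ∀ i j : Fin N, ((i : ℕ) + 1 = (j : ℕ) ∨ (j : ℕ) + 1 = (i : ℕ)) →
      SerreRel K q N
        (FreeAlgebra.ι K i * FreeAlgebra.ι K i * FreeAlgebra.ι K j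
          - (q ^ 2 + (q ^ 2)⁻¹) • (FreeAlgebra.ι K i * FreeAlgebra.ι K j * FreeAlgebra.ι K i)
          + FreeAlgebra.ι K j * FreeAlgebra.ι K i * FreeAlgebra.ι K i) 0
  | comm : ∀ i j : Fin N, ((i : ℕ) + 2 ≤ (j : ℕ) ∨ (j : ℕ) + 2 ≤ (i : ℕ)) →
      SerreRel K q N (FreeAlgebra.ι K i * FreeAlgebra.ι K j)
        (FreeAlgebra.ι K j * FreeAlgebra.ι K i)

/-- U_q^-(A_N): the free algebra on F_1, …, F_N modulo the quantum Serre relations. -/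
abbrev UqMinus (K : Type) [Field K] (q : K) (N : ℕ) := RingQuot (SerreRel K q N)

/-- The image of the generator F_i in U_q^-(A_N). -/
noncomputable def fg (K : Type) [Field K] (q : K) (N : ℕ) (i : Fin N) : UqMinus K q N :=
  RingQuot.mkAlgHom K (SerreRel K q N) (FreeAlgebra.ι K i)

/-- The index set Λ_N = {(i,j) : 1 ≤ i < j ≤ N+1}. -/
def Lam (N : ℕ) : Type := {p : ℕ × ℕ // 1 ≤ p.1 ∧ p.1 < p.2 ∧ p.2 ≤ N + 1}

/-- The element (i, i+1) of Λ_N associated to the generator F_i (for i = 1, …, N). -/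
def eGen (N : ℕ) (i : Fin N) : Lam N :=
  ⟨((i : ℕ) + 1, (i : ℕ) + 2), by have := i.isLt; omega⟩

/-- A monomial order on the finitely supported functions σ → ℕ: a well-founded strict
total order for which 0 is minimal and which is translation invariant. -/
def IsMonomialOrder (σ : Type) (r : (σ →₀ ℕ) → (σ →₀ ℕ) → Prop) : Prop :=
  WellFounded r ∧ (∀ α, ¬ r α α) ∧ (∀ α β γ, r α β → r β γ → r α γ) ∧
  (∀ α β, α ≠ β → r α β ∨ r β α) ∧ (∀ α, α ≠ 0 → r 0 α) ∧
  (∀ α β γ, r α β → r (α + γ) (β + γ))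

/-- A family of elements of an algebra satisfying the type `A` quantum Serre relations
with parameter `v`. -/
structure IsSerreFamily {K A : Type*} [Field K] [Ring A] [Algebra K A] (v : K) (F : ℕ → A) :
    Prop where
  up : ∀ i, F i * F i * F (i + 1) - (v + v⁻¹) • (F i * F (i + 1) * F i)
    + F (i + 1) * F i * F i = 0
  down : ∀ i, F (i + 1) * F (i + 1) * F i - (v + v⁻¹) • (F (i + 1) * F i * F (i + 1))
    + F i * F (i + 1) * F (i + 1) = 0
  comm : ∀ i j, i + 2 ≤ j → Commute (F i) (F j)

/-- The root vector attached to the root `α_i + ⋯ + α_{i+d}`, an iterated `v`-commutator. -/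
def rootVec {K A : Type*} [Field K] [Ring A] [Algebra K A] (v : K) (F : ℕ → A) : ℕ → ℕ → A
  | i, 0 => F i
  | i, d + 1 => rootVec v F (i + 1) d * F i - v • (F i * rootVec v F (i + 1) d)

section RootVec

variable {K A : Type*} [Field K] [Ring A] [Algebra K A] {v : K} {F : ℕ → A}

theorem rootVec_zero (i : ℕ) : rootVec v F i 0 = F i := by
  simp only [rootVec]

theorem rootVec_succ (i d : ℕ) : rootVec v F i (d + 1) =
    rootVec v F (i + 1) d * F i - v • (F i * rootVec v F (i + 1) d) := by
  simp only [rootVec]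

theorem map_rootVec {B : Type*} [Ring B] [Algebra K B] (f : A →ₐ[K] B) (i d : ℕ) :
    f (rootVec v F i d) = rootVec v (fun k => f (F k)) i d := by
  induction d generalizing i with
  | zero => simp only [rootVec]
  | succ d ih => simp only [rootVec, map_sub, map_mul, map_smul, ih]

theorem Commute.rootVec_right {x : A} {i : ℕ} (h : ∀ j, i ≤ j → Commute x (F j)) (d : ℕ) :
    Commute x (rootVec v F i d) := by
  induction d generalizing i with
  | zero => rw [rootVec_zero]; exact h i le_rfl
  | succ d ih =>
    have h1 := ih (i := i + 1) fun j hj => h j (by omega)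
    have h2 := h i le_rfl
    rw [rootVec_succ]
    exact (h1.mul_right h2).sub_right ((h2.mul_right h1).smul_right v)

namespace IsSerreFamily

theorem commute_rootVec_of_lt (hF : IsSerreFamily v F) {k i : ℕ} (h : k + 1 < i) (d : ℕ) :
    Commute (F k) (rootVec v F i d) :=
  Commute.rootVec_right (fun j hj => hF.comm k j (by omega)) d

theorem serre_rootVec (hF : IsSerreFamily v F) (k d : ℕ) :
    F k * F k * rootVec v F (k + 1) d - (v + v⁻¹) • (F k * rootVec v F (k + 1) d * F k)
      + rootVec v F (k + 1) d * F k * F k = 0 := by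
  cases d with
  | zero => simpa only [rootVec_zero] using hF.up k
  | succ d =>
    rw [rootVec_succ]
    have hc := (hF.commute_rootVec_of_lt (k := k) (i := k + 1 + 1) (by omega) d).eq
    have hs := hF.up k
    generalize rootVec v F (k + 1 + 1) d = z at *
    generalize F (k + 1) = f at *
    generalize F k = g at *
    have hc' : ∀ x, g * (z * x) = z * (g * x) := fun x => by rw [← mul_assoc, hc, mul_assoc]
    have h1 := congrArg (fun x => z * x) hs
    have h2 := congrArg (fun x => x * z) hs
    simp only [mul_sub, sub_mul, mul_add, add_mul, smul_mul_assoc, mul_smul_comm, mul_assoc,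
      mul_zero, zero_mul, smul_sub, hc, hc'] at h1 h2 ⊢
    linear_combination (norm := module) h1 - v • h2

theorem rootVec_mul_self (hv : v ≠ 0) (hF : IsSerreFamily v F) (k d : ℕ) :
    rootVec v F k (d + 1) * F k = v⁻¹ • (F k * rootVec v F k (d + 1)) := by
  have hs := hF.serre_rootVec k d
  rw [rootVec_succ]
  generalize rootVec v F (k + 1) d = z at *
  simp only [mul_sub, sub_mul, smul_mul_assoc, mul_smul_comm, mul_assoc, smul_sub, smul_smul,
    inv_mul_cancel₀ hv, one_smul, add_smul] at hs ⊢
  linear_combination (norm := module) hs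

theorem commute_rootVec_succ (hv2 : v + v⁻¹ ≠ 0) (hv : v ≠ 0) (hF : IsSerreFamily v F)
    (k d : ℕ) : Commute (F (k + 1)) (rootVec v F k (d + 2)) := by
  have hs := hF.serre_rootVec (k + 1) d
  have hs' := hF.down k
  have hc := (hF.commute_rootVec_of_lt (k := k) (i := k + 1 + 1) (by omega) d).eq
  rw [rootVec_succ, rootVec_succ]
  generalize rootVec v F (k + 1 + 1) d = z at *
  generalize F (k + 1) = f at *
  generalize F k = g at *
  have hc' : ∀ x, g * (z * x) = z * (g * x) := fun x => by rw [← mul_assoc, hc, mul_assoc]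
  have h1 := congrArg (fun x => z * x) hs'
  have h2 := congrArg (fun x => x * z) hs'
  have h3 := congrArg (fun x => g * x) hs
  have h4 := congrArg (fun x => x * g) hs
  rw [commute_iff_eq, ← sub_eq_zero]
  refine (smul_eq_zero.1 (?_ : (v + v⁻¹) • _ = (0 : A))).resolve_left hv2
  simp only [mul_sub, sub_mul, mul_add, add_mul, smul_mul_assoc, mul_smul_comm, mul_assoc,
      mul_zero, zero_mul, smul_sub, hc, hc'] at h1 h2 h3 h4 ⊢
  linear_combination (norm := skip) h1 - v ^ 2 • h2 + v ^ 2 • h3 - h4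
  match_scalars <;> field_simp <;> ring

theorem commute_rootVec_of_mem (hv2 : v + v⁻¹ ≠ 0) (hv : v ≠ 0) (hF : IsSerreFamily v F)
    {i k d : ℕ} (hik : i < k) (hkd : k < i + d) : Commute (F k) (rootVec v F i d) := by
  obtain ⟨e, rfl⟩ := Nat.exists_eq_add_of_lt hik
  induction e generalizing i d with
  | zero =>
    obtain ⟨d, rfl⟩ : ∃ d', d = d' + 2 := ⟨d - 2, by omega⟩
    exact hF.commute_rootVec_succ hv2 hv i d
  | succ e ih =>
    obtain ⟨d, rfl⟩ : ∃ d', d = d' + 1 := ⟨d - 1, by omega⟩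
    have h1 := ih (i := i + 1) (d := d) (by omega) (by omega)
    rw [show i + 1 + e + 1 = i + (e + 1) + 1 by ring] at h1
    have h2 : Commute (F (i + (e + 1) + 1)) (F i) := (hF.comm _ _ (by omega)).symm
    rw [rootVec_succ]
    exact (h1.mul_right h2).sub_right ((h2.mul_right h1).smul_right v)

/-- If `y` commutes with `f` and `v`-commutes with `x`, it `v`-commutes with `x f - v f x`. -/
theorem _root_.vCommutator_mul_of_commute {x y f : A} (hf : f * y = y * f)
    (hx : x * y = v • (y * x)) :
    (x * f - v • (f * x)) * y = v • (y * (x * f - v • (f * x))) := by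
  have h1 : x * f * y = v • (y * (x * f)) := by
    rw [mul_assoc, hf, ← mul_assoc, hx, smul_mul_assoc, mul_assoc]
  have h2 : f * x * y = v • (y * (f * x)) := by
    rw [mul_assoc, hx, mul_smul_comm, ← mul_assoc, hf, mul_assoc]
  rw [sub_mul, smul_mul_assoc, h1, h2, mul_sub, mul_smul_comm, smul_sub]

theorem rootVec_mul_rootVec_succ (hv2 : v + v⁻¹ ≠ 0) (hv : v ≠ 0) (hF : IsSerreFamily v F)
    (i e : ℕ) : rootVec v F i (e + 1) * rootVec v F (i + 1) e =
      v • (rootVec v F (i + 1) e * rootVec v F i (e + 1)) := by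
  induction e generalizing i with
  | zero =>
    have hs := hF.down i
    rw [rootVec_succ, rootVec_zero]
    simp only [mul_sub, sub_mul, smul_mul_assoc, mul_smul_comm, mul_assoc, smul_sub] at hs ⊢
    linear_combination (norm := skip) (-v) • hs
    match_scalars <;> field_simp <;> ring
  | succ e ih =>
    have h1 := (hF.commute_rootVec_succ hv2 hv i e).eq
    have h2 : rootVec v F i (e + 2) * rootVec v F (i + 2) e =
        v • (rootVec v F (i + 2) e * rootVec v F i (e + 2)) := by
      rw [rootVec_succ i (e + 1)]
      exact vCommutator_mul_of_commute (hF.commute_rootVec_of_lt (by omega) e) (ih (i + 1))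
    rw [rootVec_succ (i + 1) e]
    change rootVec v F i (e + 2) * (rootVec v F (i + 2) e * F (i + 1) -
      v • (F (i + 1) * rootVec v F (i + 2) e)) = v • ((rootVec v F (i + 2) e * F (i + 1) -
      v • (F (i + 1) * rootVec v F (i + 2) e)) * rootVec v F i (e + 2))
    generalize rootVec v F i (e + 2) = x at *
    generalize rootVec v F (i + 2) e = y at *
    generalize F (i + 1) = f at *
    have h3 : x * (y * f) = v • (y * f * x) := by
      rw [← mul_assoc, h2, smul_mul_assoc, mul_assoc, ← h1, ← mul_assoc]
    have h4 : x * (f * y) = v • (f * y * x) := by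
      rw [← mul_assoc, ← h1, mul_assoc, h2, mul_smul_comm, ← mul_assoc]
    rw [mul_sub, mul_smul_comm, h3, h4, sub_mul, smul_mul_assoc, smul_sub]

theorem rootVec_mul_rootVec (hv2 : v + v⁻¹ ≠ 0) (hv : v ≠ 0) (hF : IsSerreFamily v F)
    (i d e : ℕ) : rootVec v F i (d + e + 1) * rootVec v F (i + d + 1) e =
      v • (rootVec v F (i + d + 1) e * rootVec v F i (d + e + 1)) := by
  induction d generalizing i with
  | zero => simpa using hF.rootVec_mul_rootVec_succ hv2 hv i e
  | succ d ih =>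
    have h := ih (i + 1)
    rw [rootVec_succ, show i + (d + 1) + 1 = i + 1 + d + 1 by ring,
      show d + 1 + e = d + e + 1 by ring]
    exact vCommutator_mul_of_commute (hF.commute_rootVec_of_lt (by omega) e) h

/-- Root vectors in the same column `v`-commute. -/
theorem rootVec_column (hv2 : v + v⁻¹ ≠ 0) (hv : v ≠ 0) (hF : IsSerreFamily v F)
    {n i j : ℕ} (hij : i < j) (hjn : j ≤ n) :
    rootVec v F i (n - i) * rootVec v F j (n - j) =
      v • (rootVec v F j (n - j) * rootVec v F i (n - i)) := by
  have h := hF.rootVec_mul_rootVec hv2 hv i (j - i - 1) (n - j)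
  rwa [show j - i - 1 + (n - j) + 1 = n - i by omega, show i + (j - i - 1) + 1 = j by omega] at h

end IsSerreFamily

end RootVec

section Spanning

open Submodule

variable {K A : Type*} [Field K] [Ring A] [Algebra K A] {v : K} {F : ℕ → A}

/-- The ordered product of `g 0 ^ a 0, …, g (k - 1) ^ a (k - 1)`. -/
def orderedPow (g : ℕ → A) (k : ℕ) (a : ℕ → ℕ) : A :=
  ((List.range k).map fun i => g i ^ a i).prod

/-- The `n`-th column of root vectors. -/
def rootCol (v : K) (F : ℕ → A) (n i : ℕ) : A := rootVec v F i (n - i)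

/-- The ordered monomial in the root vectors of the first `N` columns with exponents `a`. -/
def pbwMonomial (v : K) (F : ℕ → A) (N : ℕ) (a : ℕ → ℕ → ℕ) : A :=
  ((List.range N).map fun n => orderedPow (rootCol v F n) (n + 1) (a n)).prod

theorem prod_span_range_le {γ : Type*} [Inhabited γ] (f : ℕ → γ → A) (N : ℕ) :
    ((List.range N).map fun n => span K (Set.range (f n))).prod ≤
      span K (Set.range fun a : ℕ → γ => ((List.range N).map fun n => f n (a n)).prod) := by
  induction N with
  | zero =>
    simp only [List.range_zero, List.map_nil, List.prod_nil, Set.range_const]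
    rw [Submodule.one_eq_span]
  | succ N ih =>
    rw [List.prod_range_succ]
    refine (mul_le_mul' ih le_rfl).trans ?_
    rw [span_mul_span, span_le]
    rintro _ ⟨_, ⟨a, rfl⟩, _, ⟨c, rfl⟩, rfl⟩
    refine subset_span ⟨Function.update a N c, ?_⟩
    simp only [List.prod_range_succ, Function.update_self]
    congr 2
    refine List.map_congr_left fun n hn => ?_
    rw [Function.update_of_ne (List.mem_range.1 hn).ne]

/-- The span of the powers of an element. -/
def powSpan (K : Type*) {A : Type*} [Field K] [Ring A] [Algebra K A] (x : A) : Submodule K A :=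
  span K (Set.range fun n : ℕ => x ^ n)

theorem one_le_powSpan (x : A) : 1 ≤ powSpan K x := by
  rw [Submodule.one_le]
  exact subset_span ⟨0, pow_zero x⟩

theorem powSpan_mul_self_le (x : A) : powSpan K x * span K {x} ≤ powSpan K x := by
  rw [powSpan, span_mul_span, span_le]
  rintro _ ⟨_, ⟨a, rfl⟩, _, hy, rfl⟩
  rw [Set.mem_singleton_iff] at hy
  subst hy
  exact subset_span ⟨a + 1, pow_succ _ a⟩

theorem mem_span_singleton_mul_powSpan (x y : A) (a : ℕ) :
    y * x ^ a ∈ span K {y} * powSpan K x :=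
  mul_mem_mul (mem_span_singleton_self y) (subset_span ⟨a, rfl⟩)

theorem pow_mul_mem_of_smul {x y : A} {c : K} (h : x * y = c • (y * x)) (a : ℕ) :
    x ^ a * y ∈ span K {y} * powSpan K x := by
  have key : x ^ a * y = c ^ a • (y * x ^ a) := by
    induction a with
    | zero => simp
    | succ a ih =>
      rw [pow_succ, mul_assoc, h, mul_smul_comm, ← mul_assoc, ih, smul_mul_assoc, smul_smul,
        mul_assoc, pow_succ' c]
  rw [key]
  exact smul_mem _ _ (mem_span_singleton_mul_powSpan x y a)

theorem powSpan_mul_span_singleton_le {x y : A} {M : Submodule K A}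
    (h : ∀ a : ℕ, x ^ a * y ∈ M) : powSpan K x * span K {y} ≤ M := by
  rw [powSpan, span_mul_span, span_le]
  rintro _ ⟨_, ⟨a, rfl⟩, _, hy, rfl⟩
  rw [Set.mem_singleton_iff] at hy
  subst hy
  exact h a

theorem powSpan_mul_le_of_smul {x y : A} {c : K} (h : x * y = c • (y * x)) :
    powSpan K x * span K {y} ≤ span K {y} * powSpan K x :=
  powSpan_mul_span_singleton_le (pow_mul_mem_of_smul h)

theorem powSpan_mul_le_of_smul_add {x y z : A} {c c' : K} (h : x * y = c • (y * x) + z)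
    (hz : x * z = c' • (z * x)) :
    powSpan K x * span K {y} ≤ span K {y} * powSpan K x ⊔ span K {z} * powSpan K x := by
  refine powSpan_mul_span_singleton_le fun a => ?_
  induction a with
  | zero =>
    refine mem_sup_left ?_
    simpa using mem_span_singleton_mul_powSpan (K := K) x y 0
  | succ a ih =>
    rw [pow_succ, mul_assoc, h, mul_add, mul_smul_comm, ← mul_assoc]
    refine add_mem (smul_mem _ _ ?_) (mem_sup_right (pow_mul_mem_of_smul hz a))
    have h1 := mul_mem_mul ih (mem_span_singleton_self (R := K) x)
    rw [Submodule.sup_mul, mul_assoc, mul_assoc] at h1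
    exact sup_le_sup (mul_le_mul' le_rfl (powSpan_mul_self_le x))
      (mul_le_mul' le_rfl (powSpan_mul_self_le x)) h1

/-- The span of the ordered monomials in `g 0, …, g (k - 1)`, as a product of submodules. -/
def prodPow (K : Type*) {A : Type*} [Field K] [Ring A] [Algebra K A] (g : ℕ → A) (k : ℕ) :
    Submodule K A := ((List.range k).map fun i => powSpan K (g i)).prod

theorem prodPow_succ (g : ℕ → A) (k : ℕ) :
    prodPow K g (k + 1) = prodPow K g k * powSpan K (g k) := List.prod_range_succ _ _

theorem one_le_prodPow (g : ℕ → A) (k : ℕ) : 1 ≤ prodPow K g k := by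
  induction k with
  | zero => simp [prodPow]
  | succ k ih =>
    rw [prodPow_succ]
    exact one_le_mul ih (one_le_powSpan _)

theorem prodPow_mul_le {g : ℕ → A} {c : K} {k : ℕ}
    (h : ∀ i j, i < j → j < k → g i * g j = c • (g j * g i)) (hc : c ≠ 0) {j : ℕ} (hj : j < k) :
    prodPow K g k * span K {g j} ≤ prodPow K g k := by
  induction k with
  | zero => omega
  | succ k ih =>
    rw [prodPow_succ, mul_assoc]
    rcases Nat.lt_succ_iff_lt_or_eq.1 hj with hj | rfl
    · have h1 : g k * g j = c⁻¹ • (g j * g k) := by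
        rw [h j k hj (by omega), smul_smul, inv_mul_cancel₀ hc, one_smul]
      refine (mul_le_mul' le_rfl (powSpan_mul_le_of_smul h1)).trans ?_
      rw [← mul_assoc]
      exact mul_le_mul' (ih (fun i j hij hj => h i j hij (by omega)) hj) le_rfl
    · exact mul_le_mul' le_rfl (powSpan_mul_self_le _)

theorem prodPow_mul_le_of_skew {g : ℕ → A} {c : K} {k : ℕ} {f : A}
    (h : ∀ i j, i < j → j < k → g i * g j = c • (g j * g i)) (hc : c ≠ 0)
    (hf : ∀ i < k, ∃ c' : K, g i * f = c' • (f * g i) ∨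
      ∃ j < i, g i * f = c' • (f * g i) + g j) :
    prodPow K g k * span K {f} ≤ (1 ⊔ span K {f}) * prodPow K g k := by
  induction k with
  | zero =>
    simp only [prodPow, List.range_zero, List.map_nil, List.prod_nil, one_mul, mul_one]
    exact le_sup_right
  | succ k ih =>
    have h' : ∀ i j, i < j → j < k → g i * g j = c • (g j * g i) :=
      fun i j hij hj => h i j hij (by omega)
    have ih := ih h' fun i hi => hf i (by omega)
    have ih' : prodPow K g k * (span K {f} * powSpan K (g k)) ≤
        (1 ⊔ span K {f}) * (prodPow K g k * powSpan K (g k)) := by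
      rw [← mul_assoc, ← mul_assoc]
      exact mul_le_mul' ih le_rfl
    rw [prodPow_succ, mul_assoc]
    obtain ⟨c', hc' | ⟨j, hj, hc'⟩⟩ := hf k (by omega)
    · exact (mul_le_mul' le_rfl (powSpan_mul_le_of_smul hc')).trans ih'
    · have h1 : g k * g j = c⁻¹ • (g j * g k) := by
        rw [h j k hj (by omega), smul_smul, inv_mul_cancel₀ hc, one_smul]
      refine (mul_le_mul' le_rfl (powSpan_mul_le_of_smul_add hc' h1)).trans ?_
      rw [Submodule.mul_sup]
      refine sup_le ih' ?_
      rw [← mul_assoc]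
      refine (mul_le_mul' (prodPow_mul_le h' hc hj) le_rfl).trans ?_
      rw [Submodule.sup_mul, one_mul]
      exact le_sup_left

/-- The span of the ordered monomials in the root vectors of the first `N` columns. -/
def pbwSpan (v : K) (F : ℕ → A) (N : ℕ) : Submodule K A :=
  ((List.range N).map fun n => prodPow K (rootCol v F n) (n + 1)).prod

theorem pbwSpan_succ (N : ℕ) :
    pbwSpan v F (N + 1) = pbwSpan v F N * prodPow K (rootCol v F N) (N + 1) :=
  List.prod_range_succ _ _

theorem one_le_pbwSpan (N : ℕ) : 1 ≤ pbwSpan v F N := by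
  induction N with
  | zero => simp [pbwSpan]
  | succ N ih =>
    rw [pbwSpan_succ]
    exact one_le_mul ih (one_le_prodPow _ _)

theorem IsSerreFamily.rootCol_mul (hv2 : v + v⁻¹ ≠ 0) (hv : v ≠ 0) (hF : IsSerreFamily v F)
    {n i k : ℕ} (hi : i ≤ n) (hk : k < n) :
    ∃ c : K, rootCol v F n i * F k = c • (F k * rootCol v F n i) ∨
      ∃ j < i, rootCol v F n i * F k = c • (F k * rootCol v F n i) + rootCol v F n j := by
  simp only [rootCol]
  rcases lt_trichotomy i k with hik | rfl | hik
  · refine ⟨1, Or.inl ?_⟩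
    rw [one_smul, (hF.commute_rootVec_of_mem hv2 hv hik (by omega)).eq]
  · refine ⟨v⁻¹, Or.inl ?_⟩
    obtain ⟨d, hd⟩ : ∃ d, n - i = d + 1 := ⟨n - i - 1, by omega⟩
    rw [hd, hF.rootVec_mul_self hv]
  · rcases Nat.lt_or_ge (k + 1) i with h | h
    · refine ⟨1, Or.inl ?_⟩
      rw [one_smul, (hF.commute_rootVec_of_lt h _).eq]
    · obtain rfl : i = k + 1 := by omega
      refine ⟨v, Or.inr ⟨k, by omega, ?_⟩⟩
      obtain ⟨d, hd⟩ : ∃ d, n - k = d + 1 := ⟨n - k - 1, by omega⟩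
      rw [hd, rootVec_succ, show n - (k + 1) = d by omega]
      abel

theorem IsSerreFamily.pbwSpan_mul_le (hv2 : v + v⁻¹ ≠ 0) (hv : v ≠ 0)
    (hF : IsSerreFamily v F) {N k : ℕ} (hk : k < N) :
    pbwSpan v F N * span K {F k} ≤ pbwSpan v F N := by
  induction N with
  | zero => omega
  | succ N ih =>
    have hcol : ∀ i j, i < j → j < N + 1 → rootCol v F N i * rootCol v F N j =
        v • (rootCol v F N j * rootCol v F N i) :=
      fun i j hij hj => hF.rootVec_column hv2 hv hij (by omega)
    rw [pbwSpan_succ, mul_assoc]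
    rcases Nat.lt_succ_iff_lt_or_eq.1 hk with hk | rfl
    · refine (mul_le_mul' le_rfl (prodPow_mul_le_of_skew hcol hv fun i hi =>
        hF.rootCol_mul hv2 hv (by omega) hk)).trans ?_
      rw [← mul_assoc, Submodule.mul_sup, mul_one]
      exact mul_le_mul' (sup_le le_rfl (ih hk)) le_rfl
    · have h := prodPow_mul_le hcol hv (j := k) (by omega)
      rw [show rootCol v F k k = F k by rw [rootCol, Nat.sub_self, rootVec_zero]] at h
      exact mul_le_mul' le_rfl h

theorem pbwSpan_le (N : ℕ) :
    pbwSpan v F N ≤ span K (Set.range fun a : ℕ → ℕ → ℕ => pbwMonomial v F N a) := by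
  refine le_trans ?_ (prod_span_range_le
    (fun n (a : ℕ → ℕ) => orderedPow (rootCol v F n) (n + 1) a) N)
  have h : ∀ n, prodPow K (rootCol v F n) (n + 1) ≤
      span K (Set.range fun a : ℕ → ℕ => orderedPow (rootCol v F n) (n + 1) a) :=
    fun n => prod_span_range_le (fun i (a : ℕ) => rootCol v F n i ^ a) (n + 1)
  unfold pbwSpan
  induction N with
  | zero => simp
  | succ N ih =>
    rw [List.prod_range_succ, List.prod_range_succ]
    exact mul_le_mul' ih (h N)

/-- If the `F k` with `k < N` generate the algebra, the ordered monomials span it. -/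
theorem IsSerreFamily.span_pbwMonomial (hv2 : v + v⁻¹ ≠ 0) (hv : v ≠ 0)
    (hF : IsSerreFamily v F) {N : ℕ} (hgen : Algebra.adjoin K {x | ∃ k < N, x = F k} = ⊤) :
    span K (Set.range fun a : ℕ → ℕ → ℕ => pbwMonomial v F N a) = ⊤ := by
  refine top_le_iff.1 (le_trans ?_ (pbwSpan_le N))
  have key : ∀ u : A, ∀ s ∈ pbwSpan v F N, s * u ∈ pbwSpan v F N := by
    intro u
    have hu : u ∈ Algebra.adjoin K {x | ∃ k < N, x = F k} := hgen ▸ Algebra.mem_top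
    induction hu using Algebra.adjoin_induction with
    | mem x hx =>
      obtain ⟨k, hk, rfl⟩ := hx
      exact fun s hs => hF.pbwSpan_mul_le hv2 hv hk
        (mul_mem_mul hs (mem_span_singleton_self _))
    | algebraMap r =>
      intro s hs
      rw [← Algebra.commutes, ← Algebra.smul_def]
      exact smul_mem _ _ hs
    | add x y _ _ hx hy => exact fun s hs => mul_add s x y ▸ add_mem (hx s hs) (hy s hs)
    | mul x y _ _ hx hy => exact fun s hs => mul_assoc s x y ▸ hy _ (hx s hs)
  intro u _
  simpa using key u 1 (Submodule.one_le.1 (one_le_pbwSpan N))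

end Spanning

section Feigin

variable {K B : Type*} [Field K] [Ring B] [Algebra K B] {v : K}

/-- Quantum torus relations for generators `t m i`, indexed by the positions of the letters `i`
in the word `(0)(1 0)(2 1 0)⋯` (`m` is the number of the block). -/
structure IsTorusFamily (v : K) (t : ℕ → ℕ → B) : Prop where
  comm : ∀ m m' i j, i + 2 ≤ j → Commute (t m i) (t m' j)
  same : ∀ m m' i, m < m' → t m i * t m' i = v ^ 2 • (t m' i * t m i)
  adj_le : ∀ m m' i, m' ≤ m → t m' (i + 1) * t m i = v⁻¹ • (t m i * t m' (i + 1))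
  adj_lt : ∀ m m' i, m < m' → t m' (i + 1) * t m i = v • (t m i * t m' (i + 1))

theorem serre_of_split (hv : v ≠ 0) {a b y : B} (ha : a * y = v⁻¹ • (y * a))
    (hb : b * y = v • (y * b)) (hab : a * b = v ^ 2 • (b * a)) :
    (a + b) * (a + b) * y - (v + v⁻¹) • ((a + b) * y * (a + b)) + y * (a + b) * (a + b) = 0 := by
  have ha' : ∀ x, a * (y * x) = v⁻¹ • (y * (a * x)) := fun x => by
    rw [← mul_assoc, ha, smul_mul_assoc, mul_assoc]
  have hb' : ∀ x, b * (y * x) = v • (y * (b * x)) := fun x => by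
    rw [← mul_assoc, hb, smul_mul_assoc, mul_assoc]
  simp only [add_mul, mul_add, mul_assoc, ha, hb, ha', hb', mul_smul_comm, smul_mul_assoc,
    smul_smul]
  simp only [hab, mul_smul_comm]
  match_scalars <;> field_simp <;> ring

theorem sum_smul_comm {ι κ : Type*} {s : Finset ι} {s' : Finset κ} {f : ι → B} {g : κ → B} {c : K}
    (h : ∀ i ∈ s, ∀ j ∈ s', f i * g j = c • (g j * f i)) :
    (∑ i ∈ s, f i) * (∑ j ∈ s', g j) = c • ((∑ j ∈ s', g j) * ∑ i ∈ s, f i) := by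
  rw [Finset.sum_mul_sum, Finset.sum_mul_sum, Finset.sum_comm, Finset.smul_sum]
  refine Finset.sum_congr rfl fun j hj => ?_
  rw [Finset.smul_sum]
  exact Finset.sum_congr rfl fun i hi => h i hi j hj

theorem serre_sum (hv : v ≠ 0) {x y : ℕ → B} {N : ℕ} (p : ℕ → ℕ → Prop)
    (hlt : ∀ m m' m'', p m'' m → ¬ p m'' m' → x m * x m' = v ^ 2 • (x m' * x m))
    (h1 : ∀ m m', p m' m → x m * y m' = v⁻¹ • (y m' * x m))
    (h2 : ∀ m m', ¬ p m' m → x m * y m' = v • (y m' * x m)) :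
    (∑ m ∈ Finset.range N, x m) * (∑ m ∈ Finset.range N, x m) * (∑ m ∈ Finset.range N, y m)
      - (v + v⁻¹) • ((∑ m ∈ Finset.range N, x m) * (∑ m ∈ Finset.range N, y m) *
        ∑ m ∈ Finset.range N, x m)
      + (∑ m ∈ Finset.range N, y m) * (∑ m ∈ Finset.range N, x m) *
        (∑ m ∈ Finset.range N, x m) = 0 := by
  classical
  have key : ∀ m', (∑ m ∈ Finset.range N, x m) * (∑ m ∈ Finset.range N, x m) * y m'
      - (v + v⁻¹) • ((∑ m ∈ Finset.range N, x m) * y m' * ∑ m ∈ Finset.range N, x m)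
      + y m' * (∑ m ∈ Finset.range N, x m) * (∑ m ∈ Finset.range N, x m) = 0 := by
    intro m'
    rw [← Finset.sum_filter_add_sum_filter_not (Finset.range N) (p m') x]
    have e1 : ∀ s : Finset ℕ, ∀ c : K, (∀ m ∈ s, x m * y m' = c • (y m' * x m)) →
        (∑ m ∈ s, x m) * y m' = c • (y m' * ∑ m ∈ s, x m) := by
      intro s c h
      rw [Finset.sum_mul, Finset.mul_sum, Finset.smul_sum]
      exact Finset.sum_congr rfl h
    refine serre_of_split hv (e1 _ _ fun m hm => h1 m m' (Finset.mem_filter.1 hm).2)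
      (e1 _ _ fun m hm => h2 m m' (Finset.mem_filter.1 hm).2) (sum_smul_comm fun i hi j hj => ?_)
    exact hlt i j m' (Finset.mem_filter.1 hi).2 (Finset.mem_filter.1 hj).2
  generalize (∑ m ∈ Finset.range N, x m) = X at *
  simp only [Finset.mul_sum, Finset.sum_mul, Finset.smul_sum, ← Finset.sum_sub_distrib,
    ← Finset.sum_add_distrib, key, Finset.sum_const_zero]

/-- The image of the `i`-th generator under the Feigin homomorphism. -/
def feigin (t : ℕ → ℕ → B) (N i : ℕ) : B := ∑ m ∈ Finset.range N, t m i

theorem IsTorusFamily.isSerreFamily (hv : v ≠ 0) {t : ℕ → ℕ → B} (ht : IsTorusFamily v t)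
    (N : ℕ) : IsSerreFamily v (feigin t N) where
  up i := by
    refine serre_sum hv (fun m' m => m < m') (fun m m' m'' h h' => ht.same m m' i (by omega))
      (fun m m' h => ?_) fun m m' h => ?_
    · rw [ht.adj_lt m m' i h, smul_smul, inv_mul_cancel₀ hv, one_smul]
    · rw [ht.adj_le m m' i (by omega), smul_smul, mul_inv_cancel₀ hv, one_smul]
  down i := by
    refine serre_sum hv (fun m' m => m ≤ m') (fun m m' m'' h h' => ht.same m m' _ (by omega))
      (fun m m' h => ht.adj_le m' m i h) fun m m' h => ht.adj_lt m' m i (by omega)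
  comm i j hij := Commute.sum_left _ _ _ fun m _ => Commute.sum_right _ _ _ fun m' _ =>
    ht.comm m m' i j hij

/-- The sum of the monomials of `rootVec v (feigin t N) i d` ending in `t m i`. -/
def chainSum (v : K) (t : ℕ → ℕ → B) : ℕ → ℕ → ℕ → B
  | i, 0, m => t m i
  | i, d + 1, m => (1 - v ^ 2) • ((∑ m' ∈ Finset.range (m + 1), chainSum v t (i + 1) d m') * t m i)

theorem chainSum_zero (t : ℕ → ℕ → B) (i m : ℕ) : chainSum v t i 0 m = t m i := by
  simp only [chainSum]

theorem chainSum_succ (t : ℕ → ℕ → B) (i d m : ℕ) : chainSum v t i (d + 1) m =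
    (1 - v ^ 2) • ((∑ m' ∈ Finset.range (m + 1), chainSum v t (i + 1) d m') * t m i) := by
  simp only [chainSum]

namespace IsTorusFamily

variable {t : ℕ → ℕ → B}

theorem commute_chainSum (ht : IsTorusFamily v t) {k i : ℕ} (hk : k + 1 < i) (m d m' : ℕ) :
    Commute (t m k) (chainSum v t i d m') := by
  induction d generalizing i m' with
  | zero => rw [chainSum_zero]; exact ht.comm m m' k i hk
  | succ d ih =>
    rw [chainSum_succ]
    exact ((Commute.sum_right _ _ _ fun m'' _ => ih (by omega) m'').mul_right
      (ht.comm m m' k i hk)).smul_right _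

theorem chainSum_mul (ht : IsTorusFamily v t) {i m m' : ℕ} {c : K}
    (h : t m' (i + 1) * t m i = c • (t m i * t m' (i + 1))) (d : ℕ) :
    chainSum v t (i + 1) d m' * t m i = c • (t m i * chainSum v t (i + 1) d m') := by
  cases d with
  | zero => simpa only [chainSum_zero] using h
  | succ d =>
    have hc : Commute (t m i) (∑ m'' ∈ Finset.range (m' + 1), chainSum v t (i + 1 + 1) d m'') :=
      Commute.sum_right _ _ _ fun m'' _ => ht.commute_chainSum (by omega) m d m''
    rw [chainSum_succ, smul_mul_assoc, mul_assoc, h, mul_smul_comm, ← mul_assoc, ← hc.eq,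
      mul_smul_comm, smul_comm, mul_assoc]

theorem rootVec_feigin (hv : v ≠ 0) (ht : IsTorusFamily v t) (N i d : ℕ) :
    rootVec v (feigin t N) i d = ∑ m ∈ Finset.range N, chainSum v t i d m := by
  induction d generalizing i with
  | zero => simp only [rootVec_zero, chainSum_zero, feigin]
  | succ d ih =>
    rw [rootVec_succ, ih, feigin, Finset.sum_mul_sum, Finset.sum_mul_sum, Finset.sum_comm,
      Finset.smul_sum, ← Finset.sum_sub_distrib]
    refine Finset.sum_congr rfl fun m hm => ?_
    rw [chainSum_succ, Finset.smul_sum, ← Finset.sum_sub_distrib, Finset.sum_mul, Finset.smul_sum]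
    have hsub : Finset.range (m + 1) ⊆ Finset.range N := by
      intro x hx
      simp only [Finset.mem_range] at *
      omega
    refine (Finset.sum_subset hsub fun m' _ hm' => ?_).symm.trans
      (Finset.sum_congr rfl fun m' hm' => ?_) |>.trans rfl
    · rw [ht.chainSum_mul (ht.adj_lt m m' i (by simpa using hm')), sub_self]
    · rw [ht.chainSum_mul (ht.adj_le m m' i (by simpa [Nat.lt_succ_iff] using hm'))]
      match_scalars
      field_simp

end IsTorusFamily

end Feigin

section Leading

open Finsupp

section LowVec

variable {K : Type*} [Field K] {Γ : Type*} [LinearOrder Γ]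

/-- Vectors supported strictly below `e`. -/
noncomputable def lowVec (K : Type*) [Field K] (e : Γ) : Submodule K (Γ →₀ K) :=
  Finsupp.supported K K (Set.Iio e)

theorem lowVec_mono {e e' : Γ} (h : e ≤ e') : lowVec K e ≤ lowVec K e' :=
  Finsupp.supported_mono (Set.Iio_subset_Iio h)

theorem single_mem_lowVec {e e' : Γ} (h : e < e') (c : K) : single e c ∈ lowVec K e' :=
  Finsupp.single_mem_supported K c h

/-- A nontrivial linear combination of vectors with distinct leading exponents has as leading
exponent the largest one occurring. -/
theorem exists_lead_linearCombination {ι : Type*} {w : ι → Γ →₀ K} {E : ι → Γ}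
    (hE : Function.Injective E) (hw : ∀ i, w i (E i) ≠ 0) (hw' : ∀ i x, w i x ≠ 0 → x ≤ E i)
    {s : ι →₀ K} (hs : s ≠ 0) :
    ∃ i, s i ≠ 0 ∧ (∀ j, s j ≠ 0 → E j ≤ E i) ∧ Finsupp.linearCombination K w s (E i) ≠ 0 ∧
      ∀ x, Finsupp.linearCombination K w s x ≠ 0 → x ≤ E i := by
  obtain ⟨i, hi, hmax⟩ := s.support.exists_max_image E (Finsupp.support_nonempty_iff.2 hs)
  have heval : ∀ x, Finsupp.linearCombination K w s x = ∑ j ∈ s.support, s j * w j x := by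
    intro x
    rw [Finsupp.linearCombination_apply, Finsupp.sum, Finsupp.finsetSum_apply]
    simp
  refine ⟨i, Finsupp.mem_support_iff.1 hi, fun j hj => hmax j (Finsupp.mem_support_iff.2 hj),
    ?_, fun x hx => ?_⟩
  · rw [heval, Finset.sum_eq_single i]
    · exact mul_ne_zero (Finsupp.mem_support_iff.1 hi) (hw i)
    · intro j hj hji
      by_contra hne
      exact hji (hE (le_antisymm (hmax j hj) (hw' j _ (right_ne_zero_of_mul hne))))
    · exact fun h => absurd hi h
  · rw [heval] at hx
    obtain ⟨j, hj, hne⟩ := Finset.exists_ne_zero_of_sum_ne_zero hx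
    exact (hw' j x (right_ne_zero_of_mul hne)).trans (hmax j hj)

end LowVec

variable {K : Type*} [Field K] {Γ : Type*} [AddCommMonoid Γ]

/-- The operator sending the basis vector `a` to a multiple, determined by the character `l`,
of the basis vector `a + e`. -/
noncomputable def shiftOp (v : K) (l : Γ →+ ℤ) (e : Γ) : Module.End K (Γ →₀ K) :=
  Finsupp.linearCombination K fun a => single (a + e) (v ^ l a)

theorem shiftOp_single (v : K) (l : Γ →+ ℤ) (e a : Γ) (c : K) :
    shiftOp v l e (single a c) = single (a + e) (c * v ^ l a) := by
  rw [shiftOp, linearCombination_single, smul_single, smul_eq_mul]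

theorem shiftOp_mul {v : K} (hv : v ≠ 0) (l l' : Γ →+ ℤ) (e e' : Γ) (c : K)
    (hc : c = v ^ (l e' - l' e)) :
    shiftOp v l e * shiftOp v l' e' = c • (shiftOp v l' e' * shiftOp v l e) := by
  subst hc
  refine Finsupp.lhom_ext fun a c => ?_
  simp only [Module.End.mul_apply, LinearMap.smul_apply, shiftOp_single, smul_single,
    map_add, smul_eq_mul, zpow_add₀ hv, zpow_sub₀ hv]
  rw [add_right_comm]
  congr 1
  field_simp

variable [LinearOrder Γ]

/-- Operators raising exponents by strictly less than `e`. -/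
noncomputable def lowOp (K : Type*) [Field K] (e : Γ) : Submodule K (Module.End K (Γ →₀ K)) where
  carrier := {g | ∀ a, g (single a 1) ∈ lowVec K (a + e)}
  add_mem' h h' a := add_mem (h a) (h' a)
  zero_mem' _ := zero_mem _
  smul_mem' c _ h a := Submodule.smul_mem _ c (h a)

/-- Operators whose leading exponent is `e`. -/
def HasLead (g : Module.End K (Γ →₀ K)) (e : Γ) : Prop :=
  ∀ a, ∃ c : K, c ≠ 0 ∧ g (single a 1) - single (a + e) c ∈ lowVec K (a + e)

namespace HasLead

theorem one : HasLead (1 : Module.End K (Γ →₀ K)) 0 := fun a =>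
  ⟨1, one_ne_zero, by simp⟩

theorem smul {g : Module.End K (Γ →₀ K)} {e : Γ} (h : HasLead g e) {c : K} (hc : c ≠ 0) :
    HasLead (c • g) e := fun a => by
  obtain ⟨c', hc', hl⟩ := h a
  refine ⟨c * c', mul_ne_zero hc hc', ?_⟩
  rw [LinearMap.smul_apply, ← smul_eq_mul c c', ← smul_single, ← smul_sub]
  exact Submodule.smul_mem _ c hl

theorem add_low {g g' : Module.End K (Γ →₀ K)} {e : Γ} (h : HasLead g e) (h' : g' ∈ lowOp K e) :
    HasLead (g + g') e := fun a => by
  obtain ⟨c, hc, hl⟩ := h a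
  refine ⟨c, hc, ?_⟩
  rw [LinearMap.add_apply, add_sub_right_comm]
  exact add_mem hl (h' a)

theorem apply_zero_ne {g : Module.End K (Γ →₀ K)} {e : Γ} (h : HasLead g e) :
    g (single 0 1) e ≠ 0 := by
  obtain ⟨c, hc, hl⟩ := h 0
  rw [zero_add] at hl
  have h1 : (g (single 0 1) - single e c) e = 0 := by
    by_contra hne
    exact lt_irrefl e ((Finsupp.mem_supported K _).1 hl (Finsupp.mem_support_iff.2 hne))
  rw [Finsupp.sub_apply, single_eq_same, sub_eq_zero] at h1
  rwa [h1]

theorem le_of_apply_zero {g : Module.End K (Γ →₀ K)} {e x : Γ} (h : HasLead g e)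
    (hx : g (single 0 1) x ≠ 0) : x ≤ e := by
  obtain ⟨c, hc, hl⟩ := h 0
  rw [zero_add] at hl
  by_contra hlt
  have h1 : (g (single 0 1) - single e c) x = 0 := by
    by_contra hne
    exact hlt ((Finsupp.mem_supported K _).1 hl (Finsupp.mem_support_iff.2 hne)).le
  rw [Finsupp.sub_apply, single_eq_of_ne (fun h => hlt h.le), sub_zero] at h1
  exact hx h1

variable [IsOrderedCancelAddMonoid Γ]

theorem mem_lowOp {g : Module.End K (Γ →₀ K)} {e e' : Γ} (h : HasLead g e) (he : e < e') :
    g ∈ lowOp K e' := fun a => by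
  obtain ⟨c, hc, hl⟩ := h a
  have h1 : a + e < a + e' := by gcongr
  simpa using add_mem (lowVec_mono h1.le hl) (single_mem_lowVec h1 c)

theorem map_lowVec {g : Module.End K (Γ →₀ K)} {e : Γ} (h : HasLead g e) {b : Γ} {x : Γ →₀ K}
    (hx : x ∈ lowVec K b) : g x ∈ lowVec K (b + e) := by
  rw [lowVec, Finsupp.supported_eq_span_single] at hx
  induction hx using Submodule.span_induction with
  | mem x hx =>
    obtain ⟨a, ha, rfl⟩ := hx
    have ha : a < b := ha
    obtain ⟨c, hc, hl⟩ := h a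
    have h1 : a + e < b + e := by gcongr
    simpa using add_mem (lowVec_mono h1.le hl) (single_mem_lowVec h1 c)
  | zero => rw [map_zero]; exact zero_mem _
  | add x y _ _ hx hy => rw [map_add]; exact add_mem hx hy
  | smul c x _ hx => rw [map_smul]; exact Submodule.smul_mem _ c hx

theorem mul {g g' : Module.End K (Γ →₀ K)} {e e' : Γ} (h : HasLead g e) (h' : HasLead g' e') :
    HasLead (g * g') (e + e') := fun a => by
  obtain ⟨c', hc', hl'⟩ := h' a
  obtain ⟨c, hc, hl⟩ := h (a + e')
  refine ⟨c' * c, mul_ne_zero hc' hc, ?_⟩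
  have h1 := add_mem (h.map_lowVec hl') (Submodule.smul_mem _ c' hl)
  have h2 : single (a + e') c' = c' • single (a + e') (1 : K) := by
    rw [smul_single, smul_eq_mul, mul_one]
  rw [map_sub, h2, map_smul, smul_sub, smul_single, smul_eq_mul, sub_add_sub_cancel] at h1
  rw [add_comm e e', ← add_assoc]
  exact h1

theorem pow {g : Module.End K (Γ →₀ K)} {e : Γ} (h : HasLead g e) (n : ℕ) :
    HasLead (g ^ n) (n • e) := by
  induction n with
  | zero => simpa using HasLead.one
  | succ n ih => rw [pow_succ, succ_nsmul]; exact ih.mul h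

theorem prod_range {g : ℕ → Module.End K (Γ →₀ K)} {e : ℕ → Γ} {N : ℕ}
    (h : ∀ n < N, HasLead (g n) (e n)) :
    HasLead ((List.range N).map g).prod (∑ n ∈ Finset.range N, e n) := by
  induction N with
  | zero => simpa using HasLead.one
  | succ N ih =>
    rw [List.prod_range_succ, Finset.sum_range_succ]
    exact (ih fun n hn => h n (by omega)).mul (h N (by omega))

end HasLead

theorem hasLead_shiftOp {v : K} (hv : v ≠ 0) (l : Γ →+ ℤ) (e : Γ) :
    HasLead (shiftOp v l e) e := fun a =>
  ⟨v ^ l a, zpow_ne_zero _ hv, by simp [shiftOp_single]⟩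

section Independence

variable {A ι : Type*} [Ring A] [Algebra K A] {b : ι → A} {E : ι → Γ}

theorem linearIndependent_of_hasLead (φ : A →ₐ[K] Module.End K (Γ →₀ K))
    (hE : Function.Injective E) (hb : ∀ i, HasLead (φ (b i)) (E i)) : LinearIndependent K b := by
  let L : A →ₗ[K] (Γ →₀ K) := (LinearMap.applyₗ (single 0 1)).comp φ.toLinearMap
  refine LinearIndependent.of_comp L ?_
  rw [linearIndependent_iff]
  intro s hs
  by_contra hne
  obtain ⟨i, -, -, h, -⟩ := exists_lead_linearCombination (w := L ∘ b) hE
    (fun i => (hb i).apply_zero_ne) (fun i x hx => (hb i).le_of_apply_zero hx) hne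
  exact h (by rw [hs]; rfl)

theorem exists_eq_smul_add_of_hasLead (φ : A →ₐ[K] Module.End K (Γ →₀ K))
    (hE : Function.Injective E) (hb : ∀ i, HasLead (φ (b i)) (E i))
    (hspan : Submodule.span K (Set.range b) = ⊤) {u : A} {i : ι} (hu : HasLead (φ u) (E i)) :
    ∃ (c : K) (f : A), c ≠ 0 ∧ f ∈ Submodule.span K {m | ∃ j, E j < E i ∧ m = b j} ∧
      u = c • b i + f := by
  classical
  let L : A →ₗ[K] (Γ →₀ K) := (LinearMap.applyₗ (single 0 1)).comp φ.toLinearMap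
  have hmem : u ∈ Submodule.span K (Set.range b) := hspan ▸ Submodule.mem_top
  obtain ⟨s, hs⟩ := Finsupp.mem_span_range_iff_exists_finsupp.1 hmem
  have hs' : Finsupp.linearCombination K b s = u := hs
  have hL : Finsupp.linearCombination K (L ∘ b) s = φ u (single 0 1) := by
    rw [← LinearMap.map_finsupp_linearCombination, hs']
    rfl
  have hne : s ≠ 0 := by
    rintro rfl
    exact hu.apply_zero_ne (by rw [← hL, map_zero]; rfl)
  obtain ⟨k, hk, hmax, hkne, hle⟩ := exists_lead_linearCombination (w := L ∘ b) hE
    (fun i => (hb i).apply_zero_ne) (fun i x hx => (hb i).le_of_apply_zero hx) hne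
  rw [hL] at hkne hle
  obtain rfl : k = i := hE (le_antisymm (hu.le_of_apply_zero hkne) (hle _ hu.apply_zero_ne))
  refine ⟨s k, Finsupp.linearCombination K b (s.erase k), hk, ?_, ?_⟩
  · rw [Finsupp.linearCombination_apply]
    refine Submodule.sum_mem _ fun j hj => Submodule.smul_mem _ _ (Submodule.subset_span ?_)
    rw [Finsupp.support_erase, Finset.mem_erase, Finsupp.mem_support_iff] at hj
    exact ⟨j, lt_of_le_of_ne (hmax j hj.2) fun h => hj.1 (hE h), rfl⟩
  · rw [← Finsupp.linearCombination_single, ← map_add, Finsupp.single_add_erase, hs']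

end Independence

/-- The exponent of the leading monomial of the `(i, d)`-th root vector. -/
def rootExp (δ : ℕ → ℕ → Γ) : ℕ → ℕ → Γ
  | i, 0 => δ i i
  | i, d + 1 => rootExp δ (i + 1) d + δ (i + 1 + d) i

theorem chainSum_eq_zero {B : Type*} [Ring B] [Algebra K B] {v : K} {t : ℕ → ℕ → B}
    (ht : ∀ m i, m < i → t m i = 0) {i d m : ℕ} (h : m < i + d) : chainSum v t i d m = 0 := by
  induction d generalizing i m with
  | zero => rw [chainSum_zero]; exact ht m i h
  | succ d ih =>
    rw [chainSum_succ, Finset.sum_eq_zero fun m' hm' => ih ?_, zero_mul, smul_zero]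
    have := Finset.mem_range.1 hm'
    omega

variable [IsOrderedCancelAddMonoid Γ] {v : K} {t : ℕ → ℕ → Module.End K (Γ →₀ K)}
  {δ : ℕ → ℕ → Γ} {N : ℕ}

theorem chainSum_lead (hv2 : 1 - v ^ 2 ≠ 0) (ht : ∀ m i, m < i ∨ N ≤ m → t m i = 0)
    (hlead : ∀ m i, i ≤ m → m < N → HasLead (t m i) (δ m i))
    (hδ : ∀ m n i, n < m → δ m i < δ n i) {i d : ℕ} (hN : i + d < N) :
    HasLead (chainSum v t i d (i + d)) (rootExp δ i d) ∧
      ∀ m, m ≠ i + d → chainSum v t i d m ∈ lowOp K (rootExp δ i d) := by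
  induction d generalizing i with
  | zero =>
    simp only [chainSum_zero, rootExp, add_zero]
    refine ⟨hlead i i le_rfl (by omega), fun m hm => ?_⟩
    by_cases h : m < i ∨ N ≤ m
    · rw [ht m i h]; exact zero_mem _
    · exact (hlead m i (by omega) (by omega)).mem_lowOp (hδ m i i (by omega))
  | succ d ih =>
    obtain ⟨h1, h2⟩ := ih (i := i + 1) (by omega)
    have hsum : ∀ m, i + 1 + d ≤ m → HasLead
        (∑ m' ∈ Finset.range (m + 1), chainSum v t (i + 1) d m') (rootExp δ (i + 1) d) := by
      intro m hm
      rw [← Finset.add_sum_erase _ _ (Finset.mem_range.2 (Nat.lt_succ_of_le hm))]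
      exact h1.add_low (Submodule.sum_mem _ fun m' hm' => h2 m' (Finset.ne_of_mem_erase hm'))
    have hn : i + (d + 1) = i + 1 + d := by omega
    simp only [hn, rootExp]
    refine ⟨?_, fun m hm => ?_⟩
    · rw [chainSum_succ]
      exact ((hsum _ le_rfl).mul (hlead _ i (by omega) (by omega))).smul hv2
    · by_cases h : m < i + 1 + d
      · rw [chainSum_eq_zero (fun m i h => ht m i (Or.inl h)) (by omega)]
        exact zero_mem _
      · rw [chainSum_succ]
        by_cases hmN : N ≤ m
        · rw [ht m i (Or.inr hmN), mul_zero, smul_zero]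
          exact zero_mem _
        · refine (((hsum m (by omega)).mul (hlead m i (by omega) (by omega))).smul hv2).mem_lowOp ?_
          have := hδ m (i + 1 + d) i (by omega)
          gcongr

theorem rootVec_feigin_lead (hv : v ≠ 0) (hv2 : 1 - v ^ 2 ≠ 0) (htt : IsTorusFamily v t)
    (ht : ∀ m i, m < i ∨ N ≤ m → t m i = 0)
    (hlead : ∀ m i, i ≤ m → m < N → HasLead (t m i) (δ m i))
    (hδ : ∀ m n i, n < m → δ m i < δ n i) {i d : ℕ} (hN : i + d < N) :
    HasLead (rootVec v (feigin t N) i d) (rootExp δ i d) := by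
  obtain ⟨h1, h2⟩ := chainSum_lead hv2 ht hlead hδ hN
  rw [htt.rootVec_feigin hv, ← Finset.add_sum_erase _ _ (Finset.mem_range.2 hN)]
  exact h1.add_low (Submodule.sum_mem _ fun m' hm' => h2 m' (Finset.ne_of_mem_erase hm'))

/-- The exponent of the leading monomial of a PBW monomial. -/
def pbwExp (δ : ℕ → ℕ → Γ) (N : ℕ) (a : ℕ → ℕ → ℕ) : Γ :=
  ∑ n ∈ Finset.range N, ∑ i ∈ Finset.range (n + 1), a n i • rootExp δ i (n - i)

theorem pbwMonomial_lead (hv : v ≠ 0) (hv2 : 1 - v ^ 2 ≠ 0) (htt : IsTorusFamily v t)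
    (ht : ∀ m i, m < i ∨ N ≤ m → t m i = 0)
    (hlead : ∀ m i, i ≤ m → m < N → HasLead (t m i) (δ m i))
    (hδ : ∀ m n i, n < m → δ m i < δ n i) (a : ℕ → ℕ → ℕ) :
    HasLead (pbwMonomial v (feigin t N) N a) (pbwExp δ N a) :=
  HasLead.prod_range fun n hn => HasLead.prod_range fun i hi =>
    (rootVec_feigin_lead hv hv2 htt ht hlead hδ (by omega)).pow _

end Leading

section Torus

open Finsupp

/-- The Cartan matrix of type `A`. -/
def cartanEntry (i j : ℕ) : ℤ := if i = j then 2 else if i + 1 = j ∨ j + 1 = i then -1 else 0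

/-- Half of the commutation form between the letters at the positions `p` and `p'` of the
word `(0)(1 0)(2 1 0)⋯`. -/
def torusWeight (p p' : ℕ ×ₗ ℕ) : ℤ :=
  if (ofLex p).1 < (ofLex p').1 ∨ (ofLex p).1 = (ofLex p').1 ∧ (ofLex p').2 < (ofLex p).2 then
    cartanEntry (ofLex p).2 (ofLex p').2
  else 0

/-- Exponents of monomials in the quantum torus, ordered lexicographically. -/
abbrev TorusExp : Type := Lex (ℕ ×ₗ ℕ →₀ ℕ)

/-- The exponent of the generator at position `(m, i)`. -/
noncomputable def torusGenExp (m i : ℕ) : TorusExp := toLex (single (toLex (m, i)) 1)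

/-- The coefficient of an exponent at position `p`. -/
def torusCoord (p : ℕ ×ₗ ℕ) : TorusExp →+ ℕ where
  toFun a := ofLex a p
  map_zero' := rfl
  map_add' _ _ := rfl

theorem torusCoord_genExp (n j m i : ℕ) :
    torusCoord (toLex (n, j)) (torusGenExp m i) = if n = m ∧ j = i then 1 else 0 := by
  change (single (toLex (m, i)) 1 : ℕ ×ₗ ℕ →₀ ℕ) (toLex (n, j)) = _
  rw [single_apply]
  simp only [EmbeddingLike.apply_eq_iff_eq, Prod.mk.injEq, eq_comm]

/-- The character of exponents given by the weights relative to `p`. -/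
noncomputable def torusChar (p : ℕ ×ₗ ℕ) : TorusExp →+ ℤ where
  toFun a := Finsupp.linearCombination ℕ (torusWeight p) (ofLex a)
  map_zero' := map_zero (Finsupp.linearCombination ℕ (torusWeight p))
  map_add' a b := map_add (Finsupp.linearCombination ℕ (torusWeight p)) (ofLex a) (ofLex b)

theorem torusChar_genExp (p : ℕ ×ₗ ℕ) (m i : ℕ) :
    torusChar p (torusGenExp m i) = torusWeight p (toLex (m, i)) := by
  change Finsupp.linearCombination ℕ (torusWeight p) (single (toLex (m, i)) 1) = _
  simp

variable {K : Type*} [Field K] {v : K}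

/-- The quantum torus generator at position `(m, i)`, zero for `(m, i)` not among the positions
of the first `N` blocks. -/
noncomputable def torusGen (v : K) (N m i : ℕ) : Module.End K (TorusExp →₀ K) :=
  if m < i ∨ N ≤ m then 0 else shiftOp v (torusChar (toLex (m, i))) (torusGenExp m i)

theorem torusGen_mul (hv : v ≠ 0) (N m i m' j : ℕ) {c : K}
    (hc : c = v ^ (torusWeight (toLex (m, i)) (toLex (m', j)) -
      torusWeight (toLex (m', j)) (toLex (m, i)))) :
    torusGen v N m i * torusGen v N m' j = c • (torusGen v N m' j * torusGen v N m i) := by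
  unfold torusGen
  split_ifs
  · simp
  · simp
  · simp
  · exact shiftOp_mul hv _ _ _ _ c (by rw [hc, torusChar_genExp, torusChar_genExp])

theorem isTorusFamily_torusGen (hv : v ≠ 0) (N : ℕ) : IsTorusFamily v (torusGen v N) where
  comm m m' i j hij := by
    rw [commute_iff_eq, ← one_smul K (torusGen v N m' j * torusGen v N m i)]
    refine torusGen_mul hv N m i m' j ?_
    have h1 : cartanEntry i j = 0 := by unfold cartanEntry; split_ifs <;> omega
    have h2 : cartanEntry j i = 0 := by unfold cartanEntry; split_ifs <;> omega
    simp [torusWeight, h1, h2]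
  same m m' i h := by
    refine torusGen_mul hv N m i m' i ?_
    have h1 : ¬ m' < m := by omega
    have h2 : ¬ m' = m := by omega
    simp only [torusWeight, ofLex_toLex, cartanEntry, h, h1, h2]
    norm_num
  adj_le m m' i h := by
    refine torusGen_mul hv N m' (i + 1) m i ?_
    have h1 : m' < m ∨ m' = m := by omega
    have h2 : ¬ m < m' := by omega
    simp [torusWeight, cartanEntry, h1, h2]
  adj_lt m m' i h := by
    refine torusGen_mul hv N m' (i + 1) m i ?_
    have h1 : ¬ m' < m := by omega
    have h2 : ¬ m' = m := by omega
    simp [torusWeight, cartanEntry, h, h1, h2]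

theorem torusCoord_rootExp (n j i d : ℕ) :
    torusCoord (toLex (n, j)) (rootExp torusGenExp i d) =
      if n = i + d ∧ i ≤ j ∧ j ≤ n then 1 else 0 := by
  induction d generalizing i with
  | zero =>
    rw [rootExp, torusCoord_genExp]
    congr 1
    simp only [eq_iff_iff]
    omega
  | succ d ih =>
    rw [rootExp, map_add, ih, torusCoord_genExp]
    split_ifs <;> omega

theorem torusCoord_pbwExp {n j N : ℕ} (hj : j ≤ n) (hn : n < N) (a : ℕ → ℕ → ℕ) :
    torusCoord (toLex (n, j)) (pbwExp torusGenExp N a) = ∑ i ∈ Finset.range (j + 1), a n i := by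
  simp only [pbwExp, map_sum, map_nsmul, torusCoord_rootExp, smul_eq_mul]
  rw [Finset.sum_eq_single_of_mem n (Finset.mem_range.2 hn)]
  · have hsub : Finset.range (j + 1) ⊆ Finset.range (n + 1) := by
      intro x hx
      simp only [Finset.mem_range] at *
      omega
    rw [← Finset.sum_subset hsub]
    · refine Finset.sum_congr rfl fun i hi => ?_
      have := Finset.mem_range.1 hi
      rw [if_pos (by omega), mul_one]
    · intro i hi hi'
      simp only [Finset.mem_range] at hi hi'
      rw [if_neg (by omega), mul_zero]
  · intro m hm hmn
    refine Finset.sum_eq_zero fun i hi => ?_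
    have := Finset.mem_range.1 hi
    rw [if_neg (by omega), mul_zero]

theorem eq_of_pbwExp_eq {N : ℕ} {a b : ℕ → ℕ → ℕ}
    (h : pbwExp torusGenExp N a = pbwExp torusGenExp N b) {n i : ℕ} (hi : i ≤ n) (hn : n < N) :
    a n i = b n i := by
  have key : ∀ j ≤ n, ∑ i ∈ Finset.range (j + 1), a n i = ∑ i ∈ Finset.range (j + 1), b n i := by
    intro j hj
    rw [← torusCoord_pbwExp hj hn, ← torusCoord_pbwExp hj hn, h]
  cases i with
  | zero => simpa using key 0 hi
  | succ i =>
    have h1 := key (i + 1) hi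
    rw [Finset.sum_range_succ, Finset.sum_range_succ _ (i + 1), key i (by omega)] at h1
    exact Nat.add_left_cancel h1

theorem torusGenExp_lt {m n i : ℕ} (h : n < m) : torusGenExp m i < torusGenExp n i :=
  Finsupp.Lex.single_lt_iff.2 (Prod.Lex.lt_iff.2 (Or.inl h))

/-- The ordered monomials have pairwise distinct leading exponents in the quantum torus. -/
theorem pbwMonomial_torus_lead (hv : v ≠ 0) (hv2 : 1 - v ^ 2 ≠ 0) (N : ℕ) (a : ℕ → ℕ → ℕ) :
    HasLead (pbwMonomial v (feigin (torusGen v N) N) N a) (pbwExp torusGenExp N a) := by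
  have ht : ∀ m i, m < i ∨ N ≤ m → torusGen v N m i = 0 := fun m i h => by
    rw [torusGen, if_pos h]
  have hlead : ∀ m i, i ≤ m → m < N → HasLead (torusGen v N m i) (torusGenExp m i) := by
    intro m i h h'
    rw [torusGen, if_neg (by omega)]
    exact hasLead_shiftOp hv _ _
  have hT := isTorusFamily_torusGen hv N
  generalize torusGen v N = t at *
  exact pbwMonomial_lead hv hv2 hT ht hlead (fun m n i h => torusGenExp_lt h) a

end Torus

theorem map_pbwMonomial {K A B : Type*} [Field K] [Ring A] [Algebra K A] [Ring B] [Algebra K B]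
    {v : K} {F : ℕ → A} (f : A →ₐ[K] B) (N : ℕ) (a : ℕ → ℕ → ℕ) :
    f (pbwMonomial v F N a) = pbwMonomial v (fun k => f (F k)) N a := by
  simp only [pbwMonomial, orderedPow, rootCol, map_list_prod, List.map_map, Function.comp_def,
    map_pow, map_rootVec]

theorem pbwMonomial_congr {K A : Type*} [Field K] [Ring A] [Algebra K A] {v : K} {F : ℕ → A}
    {N : ℕ} {a b : ℕ → ℕ → ℕ} (h : ∀ n i, i ≤ n → n < N → a n i = b n i) :
    pbwMonomial v F N a = pbwMonomial v F N b := by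
  unfold pbwMonomial orderedPow
  congr 1
  refine List.map_congr_left fun n hn => ?_
  congr 1
  refine List.map_congr_left fun i hi => ?_
  rw [List.mem_range] at hn hi
  rw [h n i (by omega) hn]

theorem pbwMonomial_single {K A : Type*} [Field K] [Ring A] [Algebra K A] {v : K} {F : ℕ → A}
    {N n i : ℕ} (hi : i ≤ n) (hn : n < N) {a : ℕ → ℕ → ℕ} (h1 : a n i = 1)
    (h0 : ∀ n' i', (n', i') ≠ (n, i) → a n' i' = 0) :
    pbwMonomial v F N a = rootVec v F i (n - i) := by
  unfold pbwMonomial orderedPow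
  rw [List.prod_map_eq_pow_single n, List.count_eq_one_of_mem List.nodup_range
    (List.mem_range.2 hn), pow_one, List.prod_map_eq_pow_single i,
    List.count_eq_one_of_mem List.nodup_range (List.mem_range.2 (by omega)), pow_one, h1, pow_one,
    rootCol]
  · intro i' hi' _
    rw [h0 n i' (by simp [hi']), pow_zero]
  · intro n' hn' _
    refine List.prod_eq_one fun x hx => ?_
    obtain ⟨i', -, rfl⟩ := List.mem_map.1 hx
    rw [h0 n' i' (by simp [hn']), pow_zero]

section UqMinus

variable {K : Type} [Field K] {q : K} {N : ℕ}

/-- The generators of `UqMinus K q N`, extended by zero. -/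
noncomputable def uqGen (K : Type) [Field K] (q : K) (N k : ℕ) : UqMinus K q N :=
  if h : k < N then fg K q N ⟨k, h⟩ else 0

theorem fg_serre (i j : Fin N) (h : (i : ℕ) + 1 = (j : ℕ) ∨ (j : ℕ) + 1 = (i : ℕ)) :
    fg K q N i * fg K q N i * fg K q N j
      - (q ^ 2 + (q ^ 2)⁻¹) • (fg K q N i * fg K q N j * fg K q N i)
      + fg K q N j * fg K q N i * fg K q N i = 0 := by
  have h1 := RingQuot.mkAlgHom_rel K (SerreRel.serre (K := K) (q := q) i j h)
  simp only [map_add, map_sub, map_mul, map_smul, map_zero] at h1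
  exact h1

theorem isSerreFamily_uqGen : IsSerreFamily (q ^ 2) (uqGen K q N) where
  up i := by
    unfold uqGen
    by_cases h : i + 1 < N
    · rw [dif_pos h, dif_pos (show i < N by omega)]
      exact fg_serre _ _ (Or.inl rfl)
    · simp [h]
  down i := by
    unfold uqGen
    by_cases h : i + 1 < N
    · rw [dif_pos h, dif_pos (show i < N by omega)]
      exact fg_serre _ _ (Or.inr rfl)
    · simp [h]
  comm i j hij := by
    unfold uqGen
    by_cases h : j < N
    · rw [dif_pos h, dif_pos (show i < N by omega)]
      have := RingQuot.mkAlgHom_rel K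
        (SerreRel.comm (K := K) (q := q) (⟨i, by omega⟩ : Fin N) ⟨j, h⟩ (Or.inl hij))
      rw [map_mul, map_mul] at this
      exact this
    · rw [dif_neg h]
      exact Commute.zero_right _

theorem adjoin_uqGen : Algebra.adjoin K {x | ∃ k < N, x = uqGen K q N k} = ⊤ := by
  have h1 := FreeAlgebra.adjoin_range_ι (R := K) (X := Fin N)
  have h2 := congrArg (Subalgebra.map (RingQuot.mkAlgHom K (SerreRel K q N))) h1
  rw [AlgHom.map_adjoin, Algebra.map_top,
    (AlgHom.range_eq_top _).2 (RingQuot.mkAlgHom_surjective K _)] at h2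
  rw [← h2]
  congr 1
  ext x
  simp only [Set.mem_ofPred_eq, Set.mem_image, Set.mem_range, exists_exists_eq_and]
  constructor
  · rintro ⟨k, hk, rfl⟩
    exact ⟨⟨k, hk⟩, by rw [uqGen, dif_pos hk]; rfl⟩
  · rintro ⟨k, rfl⟩
    exact ⟨k, k.2, by rw [uqGen, dif_pos k.2]; rfl⟩

/-- A Serre family in an algebra defines a homomorphism from `UqMinus K q N`. -/
noncomputable def uqLift {B : Type*} [Ring B] [Algebra K B] {F : ℕ → B}
    (hF : IsSerreFamily (q ^ 2) F) : UqMinus K q N →ₐ[K] B :=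
  RingQuot.liftAlgHom K ⟨FreeAlgebra.lift K fun i : Fin N => F i, by
    intro x y h
    induction h with
    | serre i j hij =>
      simp only [map_add, map_sub, map_mul, map_smul, map_zero, FreeAlgebra.lift_ι_apply]
      rcases hij with hij | hij
      · rw [← hij]
        exact hF.up i
      · rw [← hij]
        exact hF.down j
    | comm i j hij =>
      simp only [map_mul, FreeAlgebra.lift_ι_apply]
      rcases hij with hij | hij
      · exact (hF.comm i j hij).eq
      · exact (hF.comm j i hij).symm.eq⟩

theorem uqLift_uqGen {B : Type*} [Ring B] [Algebra K B] {F : ℕ → B}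
    (hF : IsSerreFamily (q ^ 2) F) (h0 : ∀ k, N ≤ k → F k = 0) (k : ℕ) :
    uqLift hF (uqGen K q N k) = F k := by
  unfold uqGen
  split_ifs with h
  · rw [fg, uqLift, RingQuot.liftAlgHom_mkAlgHom_apply, FreeAlgebra.lift_ι_apply]
  · rw [map_zero, h0 k (by omega)]

instance : Finite (Lam N) := by
  refine Finite.of_injective (β := Fin (N + 2) × Fin (N + 2))
    (fun p => (⟨p.1.1, by have := p.2; omega⟩, ⟨p.1.2, by have := p.2; omega⟩)) ?_
  intro p p' h
  simp only [Prod.mk.injEq, Fin.mk.injEq] at h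
  exact Subtype.ext (Prod.ext h.1 h.2)

/-- The column and row of a root vector, counted from zero. -/
def lamIndex (p : Lam N) : ℕ × ℕ := (p.1.2 - 2, p.1.1 - 1)

theorem lamIndex_injective : Function.Injective (lamIndex (N := N)) := by
  rintro ⟨⟨i, j⟩, h⟩ ⟨⟨i', j'⟩, h'⟩ hp
  simp only [lamIndex, Prod.mk.injEq] at hp
  refine Subtype.ext (Prod.ext ?_ ?_)
  · change i = i'
    omega
  · change j = j'
    omega

theorem exists_lamIndex_eq {n i : ℕ} (hi : i ≤ n) (hn : n < N) :
    ∃ p : Lam N, lamIndex p = (n, i) :=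
  ⟨⟨(i + 1, n + 2), by omega⟩, rfl⟩

/-- Exponents indexed by `Lam N`, as a function of column and row. -/
noncomputable def lamExp (α : Lam N →₀ ℕ) (n i : ℕ) : ℕ := Finsupp.mapDomain lamIndex α (n, i)

theorem lamExp_lamIndex (α : Lam N →₀ ℕ) (p : Lam N) :
    lamExp α (lamIndex p).1 (lamIndex p).2 = α p :=
  Finsupp.mapDomain_apply lamIndex_injective α p

theorem lamExp_add (α β : Lam N →₀ ℕ) (n i : ℕ) :
    lamExp (α + β) n i = lamExp α n i + lamExp β n i := by
  rw [lamExp, Finsupp.mapDomain_add]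
  rfl

/-- The leading exponent of the PBW basis element indexed by `α`. -/
noncomputable def uqExp (α : Lam N →₀ ℕ) : TorusExp := pbwExp torusGenExp N (lamExp α)

theorem uqExp_add (α β : Lam N →₀ ℕ) : uqExp (α + β) = uqExp α + uqExp β := by
  simp only [uqExp, pbwExp, lamExp_add, add_nsmul, Finset.sum_add_distrib]

theorem uqExp_injective : Function.Injective (uqExp (N := N)) := by
  intro α β h
  ext p
  have hp := p.2
  rw [← lamExp_lamIndex α p, ← lamExp_lamIndex β p]
  exact eq_of_pbwExp_eq h (by simp only [lamIndex]; omega) (by simp only [lamIndex]; omega)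

theorem uqExp_mono {α β : Lam N →₀ ℕ} (h : α ≤ β) : uqExp α ≤ uqExp β := by
  obtain ⟨γ, rfl⟩ := exists_add_of_le h
  rw [uqExp_add]
  exact le_add_of_nonneg_right bot_le

theorem isMonomialOrder_uqExp :
    IsMonomialOrder (Lam N) fun α β => uqExp α < uqExp β := by
  refine ⟨?_, fun α => lt_irrefl _, fun α β γ => lt_trans, fun α β h =>
    lt_or_gt_of_ne (uqExp_injective.ne h), fun α h => ?_, fun α β γ h => ?_⟩
  · have : IsStrictOrder (Lam N →₀ ℕ) fun α β => uqExp α < uqExp β :=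
      { irrefl := fun α => lt_irrefl _
        trans := fun α β γ => lt_trans }
    rw [RelEmbedding.wellFounded_iff_isEmpty]
    refine ⟨fun f => ?_⟩
    obtain ⟨m, n, hmn, hle⟩ := wellQuasiOrdered_le (α := Lam N →₀ ℕ) f
    have h1 : uqExp (f n) < uqExp (f m) := f.map_rel_iff.2 hmn
    exact absurd (uqExp_mono hle) h1.not_ge
  · exact lt_of_le_of_ne (uqExp_mono bot_le) (uqExp_injective.ne h.symm)
  · change uqExp (α + γ) < uqExp (β + γ)
    rw [uqExp_add, uqExp_add]
    gcongr

/-- The PBW basis of `UqMinus K q N`. -/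
noncomputable def uqBasis (K : Type) [Field K] (q : K) (N : ℕ) (α : Lam N →₀ ℕ) :
    UqMinus K q N := pbwMonomial (q ^ 2) (uqGen K q N) N (lamExp α)

theorem uqBasis_zero : uqBasis K q N 0 = 1 := by
  simp [uqBasis, pbwMonomial, orderedPow, lamExp]

theorem uqBasis_single (i : Fin N) :
    uqBasis K q N (Finsupp.single (eGen N i) 1) = fg K q N i := by
  have h : lamIndex (eGen N i) = ((i : ℕ), (i : ℕ)) := rfl
  rw [uqBasis, pbwMonomial_single (n := i) (i := i) le_rfl i.2, Nat.sub_self, rootVec_zero, uqGen,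
    dif_pos i.2]
  · rw [lamExp, Finsupp.mapDomain_single, h, Finsupp.single_eq_same]
  · intro n' i' hne
    rw [lamExp, Finsupp.mapDomain_single, h, Finsupp.single_eq_of_ne hne]

theorem span_uqBasis (hq0 : q ≠ 0) (hv2 : q ^ 2 + (q ^ 2)⁻¹ ≠ 0) :
    Submodule.span K (Set.range (uqBasis K q N)) = ⊤ := by
  rw [← isSerreFamily_uqGen.span_pbwMonomial hv2 (pow_ne_zero 2 hq0) adjoin_uqGen]
  refine le_antisymm (Submodule.span_mono ?_) (Submodule.span_mono ?_)
  · rintro _ ⟨α, rfl⟩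
    exact ⟨lamExp α, rfl⟩
  · rintro _ ⟨a, rfl⟩
    refine ⟨Finsupp.equivFunOnFinite.symm fun p => a (lamIndex p).1 (lamIndex p).2,
      pbwMonomial_congr fun n i hi hn => ?_⟩
    obtain ⟨p, hp⟩ := exists_lamIndex_eq hi hn
    have h := lamExp_lamIndex
      (Finsupp.equivFunOnFinite.symm fun p : Lam N => a (lamIndex p).1 (lamIndex p).2) p
    rw [hp] at h
    simpa [hp] using h

theorem exists_hasLead_uqBasis (hq0 : q ≠ 0) (hv2 : 1 - (q ^ 2) ^ 2 ≠ 0) :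
    ∃ φ : UqMinus K q N →ₐ[K] Module.End K (TorusExp →₀ K),
      ∀ α, HasLead (φ (uqBasis K q N α)) (uqExp α) := by
  have hv : q ^ 2 ≠ 0 := pow_ne_zero 2 hq0
  have hF := (isTorusFamily_torusGen hv N).isSerreFamily hv N
  refine ⟨uqLift hF, fun α => ?_⟩
  have h0 : ∀ k, N ≤ k → feigin (torusGen (q ^ 2) N) N k = 0 := fun k hk =>
    Finset.sum_eq_zero fun m hm => by
      have := Finset.mem_range.1 hm
      rw [torusGen, if_pos (by omega)]
  have h1 := map_pbwMonomial (v := q ^ 2) (F := uqGen K q N) (uqLift hF) N (lamExp α)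
  rw [funext (uqLift_uqGen hF h0)] at h1
  rw [uqBasis, h1]
  exact pbwMonomial_torus_lead hv hv2 N _

end UqMinus

/-- If q^8 ≠ 1 then U_q^-(A_N), presented by the quantum Serre relations, is a
solvable polynomial algebra: there are a K-basis (b_α) indexed by the finitely supported
functions α : Λ_N → ℕ, with b_0 = 1 and b_{e_{(i,i+1)}} = F_i, and a monomial order ≺ such
that b_α · b_β = c_{α,β} • b_{α+β} + f_{α,β} with c_{α,β} ≠ 0 and f_{α,β} in the span of
the b_γ with γ ≺ α + β. -/
theorem uqMinus_solvablePolynomialAlgebra (K : Type) [Field K] (q : K) (hq0 : q ≠ 0)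
    (hq8 : q ^ 8 ≠ 1) (N : ℕ) (hN : 1 ≤ N) :
    ∃ b : (Lam N →₀ ℕ) → UqMinus K q N,
      b 0 = 1 ∧
      (∀ i : Fin N, b (Finsupp.single (eGen N i) 1) = fg K q N i) ∧
      LinearIndependent K b ∧
      Submodule.span K (Set.range b) = ⊤ ∧
      ∃ r : (Lam N →₀ ℕ) → (Lam N →₀ ℕ) → Prop,
        IsMonomialOrder (Lam N) r ∧
        ∀ α β : Lam N →₀ ℕ, ∃ (c : K) (f : UqMinus K q N), c ≠ 0 ∧
          f ∈ Submodule.span K {m : UqMinus K q N | ∃ γ, r γ (α + β) ∧ m = b γ} ∧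
          b α * b β = c • b (α + β) + f := by
  have hv4 : (q ^ 2) ^ 2 ≠ 1 := fun h => hq8 (by linear_combination (q ^ 4 + 1) * h)
  have hv2 : q ^ 2 + (q ^ 2)⁻¹ ≠ 0 := by
    intro h
    field_simp at h
    exact hq8 (by linear_combination (q ^ 4 - 1) * h)
  obtain ⟨φ, hφ⟩ := exists_hasLead_uqBasis (N := N) hq0 (sub_ne_zero.2 hv4.symm)
  have hspan := span_uqBasis (N := N) hq0 hv2
  refine ⟨uqBasis K q N, uqBasis_zero, uqBasis_single,
    linearIndependent_of_hasLead φ uqExp_injective hφ, hspan, fun α β => uqExp α < uqExp β,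
    isMonomialOrder_uqExp, fun α β => ?_⟩
  refine exists_eq_smul_add_of_hasLead φ uqExp_injective hφ hspan ?_
  rw [map_mul, uqExp_add]
  exact (hφ α).mul (hφ β)
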